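/- (Corollary 4.6.) Fix 1 < p < ∞ and let p' be its Hölder conjugate. If a weight w belongs to A_p ∩ RH_∞, then w^{1−p'} belongs to A_1 with [w^{1−p'}]_{A_1} ≤ ([w]_{RH_∞} · [w]_{A_p})^{p'−1}. Conversely, if w^{1−p'} belongs to A_1, then w belongs to A_p ∩ RH_∞ with max{[w]_{RH_∞}, [w]_{A_p}} ≤ [w^{1−p'}]_{A_1}^{p−1}. -/

import Mathlib

open MeasureTheory

/-- The collection of open balls `B(x, ρ)` (with `ρ > 0`) such that the doubled ball
`B(x, 2ρ)` is contained in `Ω`. -/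
def ballsIn {n : ℕ} (Ω : Set (EuclideanSpace ℝ (Fin n))) :
    Set (Set (EuclideanSpace ℝ (Fin n))) :=
  {B | ∃ x ρ, 0 < ρ ∧ B = Metric.ball x ρ ∧ Metric.ball x (2 * ρ) ⊆ Ω}

/-- A weight on `Ω`: a measurable function that is positive a.e. on `Ω`. -/
def IsWeight {n : ℕ} (Ω : Set (EuclideanSpace ℝ (Fin n)))
    (w : EuclideanSpace ℝ (Fin n) → ℝ) : Prop :=
  Measurable w ∧ ∀ᵐ x ∂volume, x ∈ Ω → 0 < w x

/-- The `p`-mean of `w` over `B`, for an extended-real exponent `p`. -/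
noncomputable def pMean {n : ℕ} (w : EuclideanSpace ℝ (Fin n) → ℝ) (p : EReal)
    (B : Set (EuclideanSpace ℝ (Fin n))) : ℝ :=
  if p = ⊤ then essSup w (volume.restrict B)
  else if p = ⊥ then essInf w (volume.restrict B)
  else if p = 0 then Real.exp (⨍ x in B, Real.log (w x))
  else (⨍ x in B, (w x) ^ p.toReal) ^ (1 / p.toReal)

open Classical in
/-- Finiteness of the `p`-mean of `w` over `B`. -/
def MeanFinite {n : ℕ} (w : EuclideanSpace ℝ (Fin n) → ℝ) (p : EReal)
    (B : Set (EuclideanSpace ℝ (Fin n))) : Prop :=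
  if p = ⊤ then ∃ M : ℝ, ∀ᵐ x ∂(volume.restrict B), w x ≤ M
  else if p = ⊥ then ∃ m : ℝ, ∀ᵐ x ∂(volume.restrict B), m ≤ w x
  else if p = 0 then IntegrableOn (fun x => Real.log (w x)) B
  else IntegrableOn (fun x => (w x) ^ p.toReal) B

/-- `w ∈ RC(r, s, C)` over `Ω`: for every admissible ball the `r`- and `s`-means are finite
and `w(s,B) ≤ C · w(r,B)`. -/
def MemRC {n : ℕ} (Ω : Set (EuclideanSpace ℝ (Fin n)))
    (w : EuclideanSpace ℝ (Fin n) → ℝ) (r s : EReal) (C : ℝ) : Prop :=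
  ∀ B ∈ ballsIn Ω, MeanFinite w r B ∧ MeanFinite w s B ∧ pMean w s B ≤ C * pMean w r B

/-- `w ∈ RC(r,s) = ⋃_{C ≥ 1} RC(r,s,C)`. -/
def InRC {n : ℕ} (Ω : Set (EuclideanSpace ℝ (Fin n)))
    (w : EuclideanSpace ℝ (Fin n) → ℝ) (r s : EReal) : Prop :=
  ∃ C : ℝ, 1 ≤ C ∧ MemRC Ω w r s C

/-- `[w]_{RC(r,s)}`, the least admissible reversal constant. -/
noncomputable def RCconst {n : ℕ} (Ω : Set (EuclideanSpace ℝ (Fin n)))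
    (w : EuclideanSpace ℝ (Fin n) → ℝ) (r s : EReal) : ℝ :=
  sInf {C : ℝ | 1 ≤ C ∧ MemRC Ω w r s C}

lemma aux_coeff {a b C : ℝ} {q : ℝ} (hq : q < 0) (ha : 0 < a) (hb : 0 < b) (hC : 0 < C)
    (h : a ≤ C * b ^ (1 / q)) : b ≤ C ^ (-q) * a ^ q := by
  have h1 : (C * b ^ (1 / q)) ^ q ≤ a ^ q := Real.rpow_le_rpow_of_nonpos ha h hq.le
  rw [Real.mul_rpow hC.le (by positivity), ← Real.rpow_mul hb.le, one_div_mul_cancel hq.ne,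
    Real.rpow_one] at h1
  calc b = C ^ (-q) * (C ^ q * b) := by
        rw [← mul_assoc, ← Real.rpow_add hC]; simp
    _ ≤ _ := by gcongr

lemma avg_pos {α : Type*} [MeasurableSpace α] {μ : Measure α} [IsFiniteMeasure μ] (hμ : μ ≠ 0)
    {f : α → ℝ} (hf : Integrable f μ) (h : ∀ᵐ x ∂μ, 0 < f x) : 0 < ⨍ x, f x ∂μ := by
  obtain ⟨x, hx, h2⟩ := exists_notMem_null_le_average hμ hf (ae_iff.1 h)
  simp only [Set.mem_setOf_eq, not_not] at hx
  exact hx.trans_le h2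

lemma avg_le {α : Type*} [MeasurableSpace α] {μ : Measure α} [IsFiniteMeasure μ] (hμ : μ ≠ 0)
    {f : α → ℝ} {K : ℝ} (hf : Integrable f μ) (h : ∀ᵐ x ∂μ, f x ≤ K) : ⨍ x, f x ∂μ ≤ K := by
  obtain ⟨x, hx, h2⟩ := exists_notMem_null_average_le hμ hf (ae_iff.1 h)
  simp only [Set.mem_setOf_eq, not_not] at hx
  exact h2.trans hx

lemma jensen_neg {α : Type*} [MeasurableSpace α] {μ : Measure α} [IsFiniteMeasure μ] (hμ : μ ≠ 0)
    {w : α → ℝ} {q : ℝ} (hq : q < 0) (hw : ∀ᵐ x ∂μ, 0 < w x) (hi : Integrable w μ)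
    (hi' : Integrable (fun x => w x ^ q) μ) :
    (⨍ x, w x ^ q ∂μ) ^ (1 / q) ≤ ⨍ x, w x ∂μ := by
  have hA := avg_pos hμ hi hw
  have hS := avg_pos hμ hi' (hw.mono fun x hx => Real.rpow_pos_of_pos hx q)
  set A := ⨍ x, w x ∂μ with hAdef
  set S := ⨍ x, w x ^ q ∂μ with hSdef
  have hf : Integrable (fun x => w x ^ q * A ^ (-q) + w x * (-q / A)) μ :=
    (hi'.mul_const _).add (hi.mul_const _)
  have havg : ⨍ x, (w x ^ q * A ^ (-q) + w x * (-q / A)) ∂μ = S * A ^ (-q) + A * (-q / A) := by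
    unfold average
    rw [integral_add (hi'.mul_const _).to_average (hi.mul_const _).to_average,
      integral_mul_const, integral_mul_const]
    rfl
  have hpt : ∀ᵐ x ∂μ, 1 - q ≤ w x ^ q * A ^ (-q) + w x * (-q / A) := by
    filter_upwards [hw] with x hx
    have hy : 0 < w x / A := by positivity
    have e1 : w x ^ q * A ^ (-q) = (w x / A) ^ q := by
      rw [Real.div_rpow hx.le hA.le, Real.rpow_neg hA.le]; rfl
    have e2 : w x * (-q / A) = -q * (w x / A) := by ring
    rw [e1, e2]
    have h1 := Real.log_le_sub_one_of_pos hy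
    have h2 := Real.add_one_le_exp (Real.log (w x / A) * q)
    rw [← Real.rpow_def_of_pos hy] at h2
    nlinarith
  obtain ⟨x, hx, h2⟩ := exists_notMem_null_le_average hμ hf (ae_iff.1 hpt)
  simp only [Set.mem_setOf_eq, not_not] at hx
  have h3 := hx.trans h2
  rw [havg, mul_div_cancel₀ _ hA.ne'] at h3
  have h4 : 1 ≤ S * A ^ (-q) := by linarith
  have h5 : A ^ q ≤ S := by
    rw [Real.rpow_neg hA.le, ← div_eq_mul_inv, le_div_iff₀ (by positivity)] at h4
    linarith
  calc S ^ (1 / q) ≤ (A ^ q) ^ (1 / q) :=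
        Real.rpow_le_rpow_of_nonpos (by positivity) h5 (by
          rw [one_div]; exact (inv_lt_zero.2 hq).le)
    _ = A := by rw [← Real.rpow_mul hA.le, mul_one_div_cancel hq.ne, Real.rpow_one]

lemma essSup_le_aux {α : Type*} [MeasurableSpace α] {μ : Measure α} (hμ : μ ≠ 0)
    {f : α → ℝ} {K m : ℝ} (h : ∀ᵐ x ∂μ, f x ≤ K) (h' : ∀ᵐ x ∂μ, m ≤ f x) : essSup f μ ≤ K := by
  have : NeZero μ := ⟨hμ⟩
  exact essSup_le_of_ae_le K h (Filter.IsBoundedUnder.isCoboundedUnder_le ⟨m, h'⟩)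

lemma le_essInf_aux {α : Type*} [MeasurableSpace α] {μ : Measure α} (hμ : μ ≠ 0)
    {f : α → ℝ} {K : ℝ} (h : ∀ᵐ x ∂μ, K ≤ f x) : K ≤ essInf f μ := by
  have : NeZero μ := ⟨hμ⟩
  refine le_essInf_of_ae_le K h ?_
  have hne : (⋃ n : ℕ, {x | f x ≤ n}) = Set.univ := by
    ext x; simp only [Set.mem_iUnion, Set.mem_setOf_eq, Set.mem_univ, iff_true]
    exact exists_nat_ge _
  obtain ⟨N, hN⟩ : ∃ N : ℕ, μ {x | f x ≤ N} ≠ 0 := by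
    by_contra! hcon
    have := measure_iUnion_null hcon
    rw [hne] at this
    exact hμ (Measure.measure_univ_eq_zero.1 this)
  refine Filter.IsCoboundedUnder.of_frequently_le (a := (N : ℝ)) ?_
  exact frequently_ae_iff.2 hN

lemma rc_attained {n : ℕ} {Ω : Set (EuclideanSpace ℝ (Fin n))}
    {w : EuclideanSpace ℝ (Fin n) → ℝ} {r s : EReal} (h : InRC Ω w r s) :
    1 ≤ RCconst Ω w r s ∧ MemRC Ω w r s (RCconst Ω w r s) := by
  obtain ⟨C, hC⟩ := h
  have hb : BddBelow {C : ℝ | 1 ≤ C ∧ MemRC Ω w r s C} := ⟨1, fun C hC => hC.1⟩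
  have hc : IsClosed {C : ℝ | 1 ≤ C ∧ MemRC Ω w r s C} := by
    have : {C : ℝ | 1 ≤ C ∧ MemRC Ω w r s C} = Set.Ici 1 ∩ ⋂ B ∈ ballsIn Ω,
        {C : ℝ | MeanFinite w r B ∧ MeanFinite w s B ∧ pMean w s B ≤ C * pMean w r B} := by
      ext C; simp [MemRC]
    rw [this]
    refine isClosed_Ici.inter (isClosed_biInter fun B _ => ?_)
    refine isClosed_const.and (isClosed_const.and ?_)
    exact isClosed_le continuous_const (by fun_prop)
  exact hc.csInf_mem ⟨C, hC⟩ hb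

lemma rc_le {n : ℕ} {Ω : Set (EuclideanSpace ℝ (Fin n))}
    {w : EuclideanSpace ℝ (Fin n) → ℝ} {r s : EReal} {C : ℝ} (h1 : 1 ≤ C)
    (h : MemRC Ω w r s C) : RCconst Ω w r s ≤ C :=
  csInf_le ⟨1, fun _ hC => hC.1⟩ ⟨h1, h⟩

section unfold
variable {n : ℕ} (w : EuclideanSpace ℝ (Fin n) → ℝ) (B : Set (EuclideanSpace ℝ (Fin n)))

lemma pMean_top : pMean w ⊤ B = essSup w (volume.restrict B) := by simp [pMean]
lemma pMean_bot : pMean w ⊥ B = essInf w (volume.restrict B) := by simp [pMean]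
lemma pMean_real {q : ℝ} (hq : q ≠ 0) :
    pMean w (q : EReal) B = (⨍ x in B, (w x) ^ q) ^ (1 / q) := by
  simp [pMean, hq]
lemma pMean_one : pMean w 1 B = ⨍ x in B, w x := by
  have := pMean_real w B (q := 1) one_ne_zero
  simpa using this
lemma mf_top : MeanFinite w ⊤ B ↔ ∃ M : ℝ, ∀ᵐ x ∂(volume.restrict B), w x ≤ M := by
  simp [MeanFinite]
lemma mf_bot : MeanFinite w ⊥ B ↔ ∃ M : ℝ, ∀ᵐ x ∂(volume.restrict B), M ≤ w x := by
  simp [MeanFinite]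
lemma mf_real {q : ℝ} (hq : q ≠ 0) :
    MeanFinite w (q : EReal) B ↔ IntegrableOn (fun x => (w x) ^ q) B := by
  simp [MeanFinite, hq]
lemma mf_one : MeanFinite w 1 B ↔ IntegrableOn w B := by
  have := mf_real w B (q := 1) one_ne_zero
  simpa using this
end unfold

lemma ball_facts {n : ℕ} {Ω : Set (EuclideanSpace ℝ (Fin n))}
    {w : EuclideanSpace ℝ (Fin n) → ℝ} (hw : IsWeight Ω w)
    {B : Set (EuclideanSpace ℝ (Fin n))} (hB : B ∈ ballsIn Ω) :
    IsFiniteMeasure (volume.restrict B) ∧ volume.restrict B ≠ 0 ∧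
      ∀ᵐ x ∂(volume.restrict B), 0 < w x := by
  obtain ⟨x, ρ, hρ, rfl, hsub⟩ := hB
  refine ⟨⟨by simpa using measure_ball_lt_top⟩, ?_, ?_⟩
  · rw [Ne, Measure.restrict_eq_zero]
    exact (Metric.measure_ball_pos volume x hρ).ne'
  · rw [ae_restrict_iff' measurableSet_ball]
    filter_upwards [hw.2] with y hy hyB
    exact hy (hsub (Metric.ball_subset_ball (by linarith) hyB))

lemma forward_mem {n : ℕ} {Ω : Set (EuclideanSpace ℝ (Fin n))}
    {w : EuclideanSpace ℝ (Fin n) → ℝ} (hw : IsWeight Ω w) {q C₁ C₂ : ℝ} (hq : q < 0)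
    (hC₁ : 1 ≤ C₁) (hC₂ : 1 ≤ C₂)
    (h1 : MemRC Ω w (q : EReal) 1 C₁) (h2 : MemRC Ω w 1 ⊤ C₂) :
    MemRC Ω (fun x => w x ^ q) ⊥ 1 ((C₂ * C₁) ^ (-q)) := by
  intro B hB
  obtain ⟨hfin, hμ, hpos⟩ := ball_facts hw hB
  obtain ⟨a1, a2, a3⟩ := h1 B hB
  obtain ⟨-, b2, b3⟩ := h2 B hB
  rw [mf_real _ _ hq.ne] at a1
  rw [mf_one] at a2
  rw [mf_top] at b2
  rw [pMean_one, pMean_real _ _ hq.ne] at a3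
  rw [pMean_one, pMean_top] at b3
  rw [mf_bot, mf_one, pMean_one, pMean_bot]
  have hσ : ∀ᵐ x ∂(volume.restrict B), 0 < w x ^ q :=
    hpos.mono fun x hx => Real.rpow_pos_of_pos hx q
  refine ⟨⟨0, hσ.mono fun x hx => hx.le⟩, a1, ?_⟩
  have hS := avg_pos hμ a1 hσ
  have hM : ∀ᵐ x ∂(volume.restrict B), w x ≤ essSup w (volume.restrict B) :=
    ae_le_essSup b2
  have hMpos : 0 < essSup w (volume.restrict B) :=
    (avg_pos hμ a2 hpos).trans_le (avg_le hμ a2 hM)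
  have key := aux_coeff (C := C₂ * C₁) hq hMpos hS (by positivity) (by
    rw [mul_assoc]
    exact b3.trans (by gcongr))
  refine key.trans ?_
  gcongr
  refine le_essInf_aux hμ ?_
  filter_upwards [hpos, hM] with x hx hxM
  exact Real.rpow_le_rpow_of_nonpos hx hxM hq.le

lemma backward_mem {n : ℕ} {Ω : Set (EuclideanSpace ℝ (Fin n))}
    {w : EuclideanSpace ℝ (Fin n) → ℝ} (hw : IsWeight Ω w) {q C : ℝ} (hq : q < 0)
    (hC : 1 ≤ C) (h : MemRC Ω (fun x => w x ^ q) ⊥ 1 C) :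
    MemRC Ω w (q : EReal) 1 (C ^ (-(1 / q))) ∧ MemRC Ω w 1 ⊤ (C ^ (-(1 / q))) := by
  have main : ∀ B ∈ ballsIn Ω, IntegrableOn (fun x => w x ^ q) B ∧ IntegrableOn w B ∧
      (∃ M : ℝ, ∀ᵐ x ∂(volume.restrict B), w x ≤ M) ∧
      (⨍ x in B, w x ≤ C ^ (-(1 / q)) * (⨍ x in B, w x ^ q) ^ (1 / q)) ∧
      essSup w (volume.restrict B) ≤ C ^ (-(1 / q)) * ⨍ x in B, w x := by
    intro B hB
    obtain ⟨hfin, hμ, hpos⟩ := ball_facts hw hB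
    obtain ⟨a1, a2, a3⟩ := h B hB
    rw [mf_one] at a2
    rw [pMean_one, pMean_bot] at a3
    have hq' : 1 / q < 0 := one_div_neg.2 hq
    have hσ : ∀ᵐ x ∂(volume.restrict B), 0 < w x ^ q :=
      hpos.mono fun x hx => Real.rpow_pos_of_pos hx q
    have hS := avg_pos hμ a2 hσ
    have hm : ∀ᵐ x ∂(volume.restrict B), essInf (fun x => w x ^ q) (volume.restrict B) ≤ w x ^ q :=
      ae_essInf_le ⟨0, hσ.mono fun x hx => hx.le⟩
    set m := essInf (fun x => w x ^ q) (volume.restrict B)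
    set S := ⨍ x in B, w x ^ q
    have hmpos : 0 < m := by
      by_contra! hcon
      nlinarith
    have hwm : ∀ᵐ x ∂(volume.restrict B), w x ≤ m ^ (1 / q) := by
      filter_upwards [hpos, hm] with x hx hxm
      have := Real.rpow_le_rpow_of_nonpos hmpos hxm hq'.le
      rwa [← Real.rpow_mul hx.le, mul_one_div_cancel hq.ne, Real.rpow_one] at this
    have hwi : IntegrableOn w B := by
      refine Integrable.of_bound (C := m ^ (1 / q)) hw.1.aestronglyMeasurable ?_
      filter_upwards [hpos, hwm] with x hx hxm
      rwa [Real.norm_of_nonneg hx.le]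
    have hC0 : 0 < C := by linarith
    have hmS : m ^ (1 / q) ≤ C ^ (-(1 / q)) * S ^ (1 / q) := by
      refine aux_coeff hq' hS (by positivity) hC0 ?_
      rw [← Real.rpow_mul hmpos.le, mul_one_div_cancel hq'.ne, Real.rpow_one]
      exact a3
    refine ⟨a2, hwi, ⟨_, hwm⟩, (avg_le hμ hwi hwm).trans hmS, ?_⟩
    refine (essSup_le_aux hμ hwm (hpos.mono fun x hx => hx.le)).trans (hmS.trans ?_)
    gcongr
    exact jensen_neg hμ hq hpos hwi a2
  constructor
  · intro B hB
    obtain ⟨h1, h2, h3, h4, h5⟩ := main B hB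
    rw [mf_real _ _ hq.ne, mf_one, pMean_one, pMean_real _ _ hq.ne]
    exact ⟨h1, h2, h4⟩
  · intro B hB
    obtain ⟨h1, h2, h3, h4, h5⟩ := main B hB
    rw [mf_one, mf_top, pMean_one, pMean_top]
    exact ⟨h2, h3, h5⟩

/-- **Corollary 4.6.** For `1 < p < ∞` with Hölder conjugate `p'`: if `w ∈ A_p ∩ RH_∞`, then
`w^{1−p'} ∈ A₁` with `[w^{1−p'}]_{A₁} ≤ ([w]_{RH_∞}·[w]_{A_p})^{p'−1}`; conversely, if
`w^{1−p'} ∈ A₁`, then `w ∈ A_p ∩ RH_∞` with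
`max{[w]_{RH_∞}, [w]_{A_p}} ≤ [w^{1−p'}]_{A₁}^{p−1}`. -/
theorem ap_rhinf_a1_duality {n : ℕ} (hn : 1 ≤ n)
    {Ω : Set (EuclideanSpace ℝ (Fin n))} (hΩ : IsOpen Ω)
    {w : EuclideanSpace ℝ (Fin n) → ℝ} (hw : IsWeight Ω w)
    {p p' : ℝ} (hp : 1 < p) (hp' : 1 / p + 1 / p' = 1) :
    ((InRC Ω w ((1 / (1 - p) : ℝ) : EReal) 1 ∧ InRC Ω w 1 ⊤) →
      (InRC Ω (fun x => w x ^ (1 - p')) ⊥ 1 ∧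
        RCconst Ω (fun x => w x ^ (1 - p')) ⊥ 1
          ≤ (RCconst Ω w 1 ⊤ * RCconst Ω w ((1 / (1 - p) : ℝ) : EReal) 1) ^ (p' - 1))) ∧
    (InRC Ω (fun x => w x ^ (1 - p')) ⊥ 1 →
      (InRC Ω w ((1 / (1 - p) : ℝ) : EReal) 1 ∧ InRC Ω w 1 ⊤ ∧
        max (RCconst Ω w 1 ⊤) (RCconst Ω w ((1 / (1 - p) : ℝ) : EReal) 1)
          ≤ (RCconst Ω (fun x => w x ^ (1 - p')) ⊥ 1) ^ (p - 1))) := by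
  have hp0 : p ≠ 0 := by linarith
  have hp1 : 1 - p < 0 := by linarith
  have hp'0 : p' ≠ 0 := by
    rintro rfl
    rw [div_zero, add_zero, div_eq_one_iff_eq hp0] at hp'
    linarith
  have hprod : p' + p = p * p' := by
    field_simp at hp'
    linarith
  have hqe : 1 / (1 - p) = 1 - p' := by
    rw [div_eq_iff hp1.ne]; linarith
  have hq : 1 - p' < 0 := by rw [← hqe]; exact one_div_neg.2 hp1
  rw [hqe]
  constructor
  · rintro ⟨h1, h2⟩
    obtain ⟨c1, m1⟩ := rc_attained h1
    obtain ⟨c2, m2⟩ := rc_attained h2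
    have hm := forward_mem hw hq c1 c2 m1 m2
    rw [neg_sub] at hm
    have hge := Real.one_le_rpow (one_le_mul_of_one_le_of_one_le c2 c1)
      (show 0 ≤ p' - 1 by linarith)
    exact ⟨⟨_, hge, hm⟩, rc_le hge hm⟩
  · intro h
    obtain ⟨c, m⟩ := rc_attained h
    obtain ⟨m1, m2⟩ := backward_mem hw hq c m
    have he : -(1 / (1 - p')) = p - 1 := by
      rw [← hqe, one_div_one_div]; ring
    rw [he] at m1 m2
    have hge := Real.one_le_rpow c (show 0 ≤ p - 1 by linarith)
    exact ⟨⟨_, hge, m1⟩, ⟨_, hge, m2⟩, max_le (rc_le hge m2) (rc_le hge m1)⟩
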